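/- Even moments of the bifurcation ratio deviation: for every fixed r ≥ 1 and s ≥ 0, the expectation ⟨(S_{r+1,n}/S_{r,n} − 1/4)^{2s}⟩ under P_n is asymptotically equivalent, as n → ∞, to ((2s−1)!!/4^{2s})·(n/4^{r−1})^{−s}, i.e. the ratio of the two sides tends to 1. -/

import Mathlib

open MeasureTheory ProbabilityTheory Filter
open scoped NNReal Topology

/-- Binary trees: every internal node has exactly two children. -/
inductive BinTree : Type
  | leaf : BinTree
  | node : BinTree → BinTree → BinTree
  deriving DecidableEq

namespace BinTree

/-- The magnitude of a binary tree is its number of leaves. -/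
def magnitude : BinTree → ℕ
  | leaf => 1
  | node l r => magnitude l + magnitude r

/-- The Horton–Strahler order of (the root of) a binary tree:
leaves have order 1; a node whose two children have distinct orders has the max of the two;
a node whose two children have equal order `r` has order `r + 1`. -/
def ord : BinTree → ℕ
  | leaf => 1
  | node l r => if ord l = ord r then ord l + 1 else max (ord l) (ord r)

/-- `branches k τ` is `S_{k,n}(τ)`, the number of Horton–Strahler branches of order `k`
in `τ`, i.e. the number of maximal connected paths of nodes of order `k`.  It counts the
nodes of order `k` that head a branch: a new branch head of order `ord l + 1` is created
exactly at a node whose two children have equal order `ord l`, and every leaf heads an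
order-1 branch. -/
def branches (k : ℕ) : BinTree → ℕ
  | leaf => if k = 1 then 1 else 0
  | node l r => branches k l + branches k r +
      (if ord l = ord r ∧ ord l + 1 = k then 1 else 0)

end BinTree

/-- `treesOf n` is the finite set `Ω_n` of binary trees of magnitude `n`. -/
def treesOf : ℕ → Finset BinTree
  | 0 => ∅
  | 1 => {BinTree.leaf}
  | (n+2) => (Finset.range (n+1)).attach.biUnion fun k =>
      ((treesOf (k.1+1)) ×ˢ (treesOf (n+1-k.1))).image fun p => BinTree.node p.1 p.2
  decreasing_by
  · have := Finset.mem_range.mp k.2; omega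
  · omega

/-- Expectation `⟨f⟩` under the uniform probability measure `P_n` on `Ω_n` (the random model). -/
noncomputable def expect (n : ℕ) (f : BinTree → ℝ) : ℝ :=
  (∑ τ ∈ treesOf n, f τ) / (treesOf n).card

namespace BinTree

theorem magnitude_pos (τ : BinTree) : 0 < τ.magnitude := by
  induction τ with
  | leaf => simp [magnitude]
  | node l r hl hr => simp [magnitude]; omega

theorem ord_pos (τ : BinTree) : 0 < τ.ord := by
  induction τ with
  | leaf => simp [ord]
  | node l r hl hr => simp only [ord]; split_ifs <;> simp [hl]

theorem branches_one (τ : BinTree) : τ.branches 1 = τ.magnitude := by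
  induction τ with
  | leaf => simp [branches, magnitude]
  | node l r hl hr => simp [branches, magnitude, hl, hr, (ord_pos l).ne']

/-- Removes all leaves of a binary tree and contracts the nodes left with a single child;
nothing remains of a single leaf. -/
def prune : BinTree → Option BinTree
  | leaf => none
  | node l r =>
    match prune l, prune r with
    | none, none => some leaf
    | none, some b => some b
    | some a, none => some a
    | some a, some b => some (node a b)

theorem prune_eq_none_iff {τ : BinTree} : τ.prune = none ↔ τ = leaf := by
  cases τ with
  | leaf => simp [prune]
  | node l r => rw [prune]; split <;> simp

theorem ord_of_prune {τ σ : BinTree} (h : τ.prune = some σ) : τ.ord = σ.ord + 1 := by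
  induction τ generalizing σ with
  | leaf => simp [prune] at h
  | node l r hl hr =>
    rcases hl' : l.prune with _ | a <;> rcases hr' : r.prune with _ | b <;>
      simp only [prune, hl', hr', Option.some.injEq] at h <;> subst h
    · simp [prune_eq_none_iff.1 hl', prune_eq_none_iff.1 hr', ord]
    · have := hr hr'
      have := ord_pos b
      simp only [prune_eq_none_iff.1 hl', ord]
      rw [if_neg (by omega)]; omega
    · have := hl hl'
      have := ord_pos a
      simp only [prune_eq_none_iff.1 hr', ord]
      rw [if_neg (by omega)]; omega
    · simp only [ord, hl hl', hr hr']
      split_ifs <;> omega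

theorem branches_of_prune {τ σ : BinTree} (h : τ.prune = some σ) {k : ℕ} (hk : 1 ≤ k) :
    τ.branches (k + 1) = σ.branches k := by
  induction τ generalizing σ with
  | leaf => simp [prune] at h
  | node l r hl hr =>
    rcases hl' : l.prune with _ | a <;> rcases hr' : r.prune with _ | b <;>
      simp only [prune, hl', hr', Option.some.injEq] at h <;> subst h
    · simp [prune_eq_none_iff.1 hl', prune_eq_none_iff.1 hr', branches, ord, eq_comm]
      omega
    · have := ord_of_prune hr'
      have := ord_pos b
      simp only [prune_eq_none_iff.1 hl', branches, ord, hr hr']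
      rw [if_neg (by omega), if_neg (by omega)]; omega
    · have := ord_of_prune hl'
      have := ord_pos a
      simp only [prune_eq_none_iff.1 hr', branches, ord, hl hl']
      rw [if_neg (by omega), if_neg (by omega)]; omega
    · simp only [branches, ord_of_prune hl', ord_of_prune hr', hl hl', hr hr', add_left_inj]

theorem magnitude_le_of_prune {τ σ : BinTree} (h : τ.prune = some σ) :
    σ.magnitude ≤ τ.magnitude := by
  induction τ generalizing σ with
  | leaf => simp [prune] at h
  | node l r hl hr =>
    have := magnitude_pos l
    rcases hl' : l.prune with _ | a <;> rcases hr' : r.prune with _ | b <;>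
      simp only [prune, hl', hr', Option.some.injEq] at h <;> subst h
    · simp only [magnitude]; omega
    · simp only [magnitude]; have := hr hr'; omega
    · simp only [magnitude]; have := hl hl'; omega
    · simp only [magnitude]; have := hl hl'; have := hr hr'; omega

theorem mem_treesOf {τ : BinTree} {n : ℕ} : τ ∈ treesOf n ↔ τ.magnitude = n := by
  induction τ generalizing n with
  | leaf =>
    match n with
    | 0 => simp [treesOf, magnitude]
    | 1 => simp [treesOf]; rfl
    | n + 2 => simp [treesOf, magnitude]
  | node l r hl hr =>
    have := magnitude_pos l
    have := magnitude_pos r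
    match n with
    | 0 => simp [treesOf, magnitude]; omega
    | 1 => simp [treesOf, magnitude]; omega
    | n + 2 =>
      simp only [treesOf, Finset.mem_biUnion, Finset.mem_attach, Finset.mem_image,
        Finset.mem_product, true_and, Subtype.exists, Finset.mem_range, Prod.exists, node.injEq,
        magnitude]
      constructor
      · rintro ⟨k, hk, a, b, ⟨ha, hb⟩, rfl, rfl⟩
        rw [hl.1 ha, hr.1 hb]; omega
      · intro h
        exact ⟨l.magnitude - 1, by omega, l, r, ⟨hl.2 (by omega), hr.2 (by omega)⟩, rfl, rfl⟩

theorem sum_treesOf_add_two (n : ℕ) (f : BinTree → ℝ) :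
    ∑ τ ∈ treesOf (n + 2), f τ = ∑ p ∈ Finset.HasAntidiagonal.antidiagonal (n + 2),
      ∑ l ∈ treesOf p.1, ∑ r ∈ treesOf p.2, f (node l r) := by
  simp_rw [← Finset.sum_product']
  rw [Finset.sum_sigma']
  symm
  refine Finset.sum_bij (fun x _ => node x.2.1 x.2.2) ?_ ?_ ?_ ?_
  · rintro ⟨⟨i, j⟩, l, r⟩ h
    simp only [Finset.mem_sigma, Finset.HasAntidiagonal.mem_antidiagonal, Finset.mem_product, mem_treesOf] at h
    simp only [mem_treesOf, magnitude]; omega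
  · rintro ⟨⟨i, j⟩, l, r⟩ h ⟨⟨i', j'⟩, l', r'⟩ h' heq
    simp only [Finset.mem_sigma, Finset.HasAntidiagonal.mem_antidiagonal, Finset.mem_product, mem_treesOf] at h h'
    simp only [node.injEq] at heq
    obtain ⟨rfl, rfl⟩ := heq
    obtain ⟨-, rfl, rfl⟩ := h
    obtain ⟨-, rfl, rfl⟩ := h'
    rfl
  · intro τ hτ
    cases τ with
    | leaf => simp [mem_treesOf, magnitude] at hτ
    | node l r =>
      refine ⟨⟨(l.magnitude, r.magnitude), l, r⟩, ?_, rfl⟩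
      simpa [mem_treesOf, magnitude] using hτ
  · intros; rfl

/-- The generating function of binary trees by magnitude, each tree weighted by `f`. -/
noncomputable def genFun (f : BinTree → ℝ) : PowerSeries ℝ :=
  PowerSeries.mk fun n => ∑ τ ∈ treesOf n, f τ

theorem genFun_add (f g : BinTree → ℝ) : genFun (f + g) = genFun f + genFun g := by
  ext n; simp [genFun, Finset.sum_add_distrib]

theorem genFun_of_node_eq_mul {f g h : BinTree → ℝ} (h₀ : f leaf = 0)
    (h₁ : ∀ l r, f (node l r) = g l * h r) : genFun f = genFun g * genFun h := by
  ext n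
  rw [PowerSeries.coeff_mul]
  simp only [genFun, PowerSeries.coeff_mk]
  match n with
  | 0 => simp [treesOf]
  | 1 => simp [treesOf, h₀, Finset.Nat.antidiagonal_succ]
  | n + 2 => simp_rw [sum_treesOf_add_two, h₁, Finset.sum_mul_sum]

theorem genFun_prune_none : genFun (fun τ => if τ.prune = none then 1 else 0) = PowerSeries.X := by
  ext n
  simp [genFun, prune_eq_none_iff, mem_treesOf, magnitude, PowerSeries.coeff_X, eq_comm]

/-- The generating function of the trees that are pruned to `σ`. -/
noncomputable def fiberGenFun (σ : BinTree) : PowerSeries ℝ :=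
  genFun fun τ => if τ.prune = some σ then 1 else 0

open PowerSeries in
theorem fiberGenFun_eq_add {σ : BinTree} {u : BinTree → ℝ} (hu : u leaf = 0)
    (h : ∀ l r, u (node l r) = if l.prune ≠ none ∧ r.prune ≠ none ∨ l.prune = none ∧ r.prune = none
      then (if (node l r).prune = some σ then 1 else 0) else 0) :
    fiberGenFun σ * (1 - C 2 * X) = genFun u := by
  set χ : BinTree → ℝ := fun τ => if τ.prune = some σ then 1 else 0
  set e : BinTree → ℝ := fun τ => if τ.prune = none then 1 else 0
  let v : BinTree → ℝ := fun τ => match τ with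
    | leaf => 0
    | node l r => e l * χ r
  let w : BinTree → ℝ := fun τ => match τ with
    | leaf => 0
    | node l r => χ l * e r
  have hχ : χ = u + (v + w) := by
    ext τ
    cases τ with
    | leaf => simp [χ, v, w, hu, prune]
    | node l r =>
      simp only [Pi.add_apply, h, v, w, χ, e]
      rcases hl : l.prune with _ | c <;> rcases hr : r.prune with _ | d <;>
        simp [prune, hl, hr]
  have hv : genFun v = X * fiberGenFun σ := by
    rw [← genFun_prune_none]; exact genFun_of_node_eq_mul rfl fun _ _ => rfl
  have hw : genFun w = fiberGenFun σ * X := by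
    rw [← genFun_prune_none]; exact genFun_of_node_eq_mul rfl fun _ _ => rfl
  have : fiberGenFun σ = genFun u + (X * fiberGenFun σ + fiberGenFun σ * X) := by
    conv_lhs => rw [fiberGenFun]
    change genFun χ = _
    rw [hχ, genFun_add, genFun_add, hv, hw]
  have h2 : (C 2 : PowerSeries ℝ) = 2 := map_ofNat C 2
  rw [h2]
  linear_combination this

open PowerSeries in
theorem fiberGenFun_mul (σ : BinTree) :
    fiberGenFun σ * (1 - C 2 * X) ^ (2 * σ.magnitude - 1) = X ^ (2 * σ.magnitude) := by
  induction σ with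
  | leaf =>
    let e : BinTree → ℝ := fun τ => if τ.prune = none then 1 else 0
    let u : BinTree → ℝ := fun τ => match τ with
      | leaf => 0
      | node l r => e l * e r
    have hu : genFun u = X * X := by
      rw [← genFun_prune_none]; exact genFun_of_node_eq_mul rfl fun _ _ => rfl
    simp only [magnitude, mul_one, Nat.reduceSub, pow_one]
    rw [fiberGenFun_eq_add (u := u) rfl, hu, sq]
    intro l r
    simp only [u, e]
    rcases hl : l.prune with _ | a <;> rcases hr : r.prune with _ | b <;> simp [prune, hl, hr]
  | node a b ha hb =>
    let u : BinTree → ℝ := fun τ => match τ with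
      | leaf => 0
      | node l r => (if l.prune = some a then 1 else 0) * (if r.prune = some b then 1 else 0)
    have hu : genFun u = fiberGenFun a * fiberGenFun b :=
      genFun_of_node_eq_mul rfl fun _ _ => rfl
    have hab : fiberGenFun (node a b) * (1 - C 2 * X) = fiberGenFun a * fiberGenFun b := by
      rw [← hu]
      refine fiberGenFun_eq_add rfl fun l r => ?_
      simp only [u]
      rcases hl : l.prune with _ | c <;> rcases hr : r.prune with _ | d <;>
        simp [prune, hl, hr, ← ite_and, and_comm]
    have := magnitude_pos a
    have := magnitude_pos b
    have he : 2 * (node a b).magnitude - 1 =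
        1 + ((2 * a.magnitude - 1) + (2 * b.magnitude - 1)) := by
      simp only [magnitude]; omega
    rw [he, pow_add, pow_one, ← mul_assoc, hab, pow_add, mul_mul_mul_comm, ha, hb, ← pow_add]
    simp only [magnitude]; ring_nf

open PowerSeries in
/-- The number of trees of magnitude `n` that are pruned to a given tree of magnitude `m`. -/
theorem card_fiber {n : ℕ} (hn : 2 ≤ n) (σ : BinTree) :
    ∑ τ ∈ treesOf n, (if τ.prune = some σ then (1 : ℝ) else 0) =
      (n - 2).choose (2 * σ.magnitude - 2) * 2 ^ (n - 2 * σ.magnitude) := by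
  have hpos := magnitude_pos σ
  obtain ⟨d, hd⟩ : ∃ d, 2 * σ.magnitude = d + 2 := ⟨2 * σ.magnitude - 2, by omega⟩
  have hσ := fiberGenFun_mul σ
  rw [hd, show d + 2 - 1 = d + 1 by omega] at hσ
  set A : PowerSeries ℝ := rescale 2 (mk fun n => ((d + n).choose d : ℝ))
  have hA : A * (1 - C 2 * X) ^ (d + 1) = 1 := by
    have := congrArg (rescale (2 : ℝ)) (mk_add_choose_mul_one_sub_pow_eq_one ℝ d)
    simpa [A, map_mul, map_pow, rescale_X] using this
  have hfib : fiberGenFun σ = X ^ (d + 2) * A := by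
    calc fiberGenFun σ = fiberGenFun σ * (A * (1 - C 2 * X) ^ (d + 1)) := by rw [hA, mul_one]
      _ = (fiberGenFun σ * (1 - C 2 * X) ^ (d + 1)) * A := by ring
      _ = _ := by rw [hσ]
  have hc := congrArg (coeff n) hfib
  rw [coeff_X_pow_mul'] at hc
  simp only [fiberGenFun, genFun, coeff_mk] at hc
  rw [hc, hd]
  split_ifs with h
  · simp only [A, coeff_rescale, coeff_mk]
    rw [show d + (n - (d + 2)) = n - 2 by omega, show d + 2 - 2 = d by omega, mul_comm]
  · rw [Nat.choose_eq_zero_of_lt (by omega)]; simp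

theorem card_treesOf_succ (n : ℕ) : (treesOf (n + 1)).card = catalan n := by
  induction n using Nat.strong_induction_on with
  | _ n ih =>
    match n with
    | 0 => simp [treesOf]
    | n + 1 =>
      have h := sum_treesOf_add_two n fun _ => 1
      simp only [Finset.sum_const, nsmul_eq_mul, mul_one] at h
      rw [catalan_succ', ← Nat.cast_inj (R := ℝ), h, Finset.Nat.antidiagonal_succ_succ']
      simp only [treesOf, Finset.card_empty, Nat.cast_zero, zero_mul, mul_zero, Finset.sum_cons,
        Finset.sum_map, zero_add, Nat.cast_sum, Nat.cast_mul]
      refine Finset.sum_congr rfl fun p hp => ?_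
      rw [Finset.HasAntidiagonal.mem_antidiagonal] at hp
      simp only [Function.Embedding.prodMap, Function.Embedding.coeFn_mk, Prod.map, Nat.succ_eq_add_one]
      rw [← ih p.1 (by omega), ← ih p.2 (by omega)]

theorem card_treesOf_pos {n : ℕ} (hn : 1 ≤ n) : 0 < (treesOf n).card := by
  obtain ⟨n, rfl⟩ := Nat.exists_eq_add_of_le' hn
  rw [card_treesOf_succ]
  have := succ_mul_catalan_eq_centralBinom n
  have := n.centralBinom_pos
  exact Nat.pos_of_ne_zero fun h => by simp_all

/-- The probability that pruning a uniform tree of magnitude `n` yields a tree of magnitude `m`. -/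
noncomputable def pruneProb (n m : ℕ) : ℝ :=
  (n - 2).choose (2 * m - 2) * 2 ^ (n - 2 * m) * (treesOf m).card / (treesOf n).card

theorem pruneProb_nonneg (n m : ℕ) : 0 ≤ pruneProb n m := by
  unfold pruneProb; positivity

theorem pruneProb_zero_right (n : ℕ) : pruneProb n 0 = 0 := by
  simp [pruneProb, treesOf]

theorem pruneProb_self {n : ℕ} (hn : 2 ≤ n) : pruneProb n n = 0 := by
  rw [pruneProb, Nat.choose_eq_zero_of_lt (show n - 2 < 2 * n - 2 by omega)]; simp

theorem expect_eq_sum_pruneProb {n : ℕ} (hn : 2 ≤ n) {f g : BinTree → ℝ}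
    (h : ∀ τ σ, τ.magnitude = n → τ.prune = some σ → f τ = g σ) :
    expect n f = ∑ m ∈ Finset.range (n + 1), pruneProb n m * expect m g := by
  have hf : ∀ τ ∈ treesOf n, f τ = ∑ m ∈ Finset.range (n + 1), ∑ σ ∈ treesOf m,
      (if τ.prune = some σ then (1 : ℝ) else 0) * g σ := by
    intro τ hτ
    rw [mem_treesOf] at hτ
    rcases hp : τ.prune with _ | σ
    · rw [prune_eq_none_iff.1 hp] at hτ
      simp only [magnitude] at hτ; omega
    · have := magnitude_le_of_prune hp
      rw [Finset.sum_eq_single σ.magnitude, Finset.sum_eq_single σ, h τ σ hτ hp]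
      · simp
      · intro ρ _ hρ
        simp [hρ.symm]
      · intro hσ
        exact absurd (mem_treesOf.2 rfl) hσ
      · intro m _ hm
        refine Finset.sum_eq_zero fun ρ hρ => ?_
        have : σ ≠ ρ := by rintro rfl; exact hm (mem_treesOf.1 hρ).symm
        simp [this]
      · intro hm
        exact absurd (Finset.mem_range.2 (by omega)) hm
  rw [expect, Finset.sum_congr rfl hf, Finset.sum_comm, Finset.sum_div]
  refine Finset.sum_congr rfl fun m _ => ?_
  rw [Finset.sum_comm]
  have hs : ∀ σ ∈ treesOf m, ∑ τ ∈ treesOf n, (if τ.prune = some σ then (1 : ℝ) else 0) * g σ =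
      (n - 2).choose (2 * m - 2) * 2 ^ (n - 2 * m) * g σ := by
    intro σ hσ
    rw [← Finset.sum_mul, card_fiber hn, mem_treesOf.1 hσ]
  rw [Finset.sum_congr rfl hs, ← Finset.mul_sum, pruneProb, expect]
  rcases Nat.eq_zero_or_pos m with rfl | hm
  · simp [treesOf]
  · have : ((treesOf m).card : ℝ) ≠ 0 := by exact_mod_cast (card_treesOf_pos hm).ne'
    field_simp

theorem expect_const {n : ℕ} (hn : 1 ≤ n) (c : ℝ) : expect n (fun _ => c) = c := by
  have : ((treesOf n).card : ℝ) ≠ 0 := by exact_mod_cast (card_treesOf_pos hn).ne'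
  simp [expect, this]

theorem expect_comp_magnitude {n : ℕ} (hn : 1 ≤ n) (φ : ℕ → ℝ) :
    expect n (fun τ => φ τ.magnitude) = φ n := by
  rw [← expect_const hn (φ n)]
  simp only [expect]
  rw [Finset.sum_congr rfl fun τ hτ => by rw [mem_treesOf.1 hτ]]

theorem expect_eq_sum_of_magnitude {n : ℕ} (hn : 2 ≤ n) {f : BinTree → ℝ} {φ : ℕ → ℝ}
    (h : ∀ τ σ, τ.magnitude = n → τ.prune = some σ → f τ = φ σ.magnitude) :
    expect n f = ∑ m ∈ Finset.range (n + 1), pruneProb n m * φ m := by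
  rw [expect_eq_sum_pruneProb hn (g := fun σ => φ σ.magnitude) h]
  refine Finset.sum_congr rfl fun m _ => ?_
  rcases Nat.eq_zero_or_pos m with rfl | hm
  · simp [pruneProb_zero_right]
  · rw [expect_comp_magnitude hm]

theorem sum_pruneProb {n : ℕ} (hn : 2 ≤ n) :
    ∑ m ∈ Finset.range (n + 1), pruneProb n m = 1 := by
  rw [← expect_const (by omega : 1 ≤ n) 1,
    expect_eq_sum_of_magnitude hn (φ := fun _ => 1) fun _ _ _ _ => rfl]
  simp

theorem card_treesOf_mul_succ {m : ℕ} (hm : 1 ≤ m) :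
    ((treesOf (m + 1)).card : ℝ) * (m + 1) = 2 * (2 * m - 1) * (treesOf m).card := by
  obtain ⟨k, rfl⟩ := Nat.exists_eq_add_of_le' hm
  rw [card_treesOf_succ, card_treesOf_succ]
  have h1 := succ_mul_catalan_eq_centralBinom k
  have h2 := succ_mul_catalan_eq_centralBinom (k + 1)
  have h3 := k.succ_mul_centralBinom_succ
  rw [← h1, ← h2] at h3
  have h3' : ((k : ℝ) + 1) * ((k + 1 + 1) * catalan (k + 1)) =
      2 * (2 * k + 1) * ((k + 1) * catalan k) := by exact_mod_cast h3
  have hk : (k : ℝ) + 1 ≠ 0 := by positivity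
  push_cast
  apply mul_left_cancel₀ hk
  linear_combination h3'

theorem pruneProb_succ {n : ℕ} (hn : 2 ≤ n) (m : ℕ) :
    pruneProb n (m + 1) * (4 * (m + 1) * m) =
      pruneProb n m * ((n - 2 * m) * (n - 2 * m - 1)) := by
  rcases Nat.eq_zero_or_pos m with rfl | hm
  · simp [pruneProb_zero_right]
  have hcard := card_treesOf_mul_succ hm
  obtain ⟨k, rfl⟩ := Nat.exists_eq_add_of_le' hm
  obtain ⟨N, rfl⟩ := Nat.exists_eq_add_of_le' hn
  simp only [pruneProb]
  rw [show N + 2 - 2 = N by omega, show 2 * (k + 1 + 1) - 2 = 2 * k + 1 + 1 by omega,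
    show 2 * (k + 1) - 2 = 2 * k by omega]
  rcases lt_or_ge N (2 * k + 2) with hlt | hge
  · rw [Nat.choose_eq_zero_of_lt (show N < 2 * k + 1 + 1 by omega)]
    rcases lt_or_ge N (2 * k) with hlt' | hge'
    · rw [Nat.choose_eq_zero_of_lt hlt']; simp
    · obtain rfl | rfl : N = 2 * k ∨ N = 2 * k + 1 := by omega
      · push_cast; ring
      · push_cast; ring
  · have e1 := N.choose_succ_right_eq (2 * k)
    have e2 := N.choose_succ_right_eq (2 * k + 1)
    obtain ⟨j, rfl⟩ := Nat.exists_eq_add_of_le' hge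
    rw [show j + (2 * k + 2) - 2 * k = j + 2 by omega] at e1
    rw [show j + (2 * k + 2) - (2 * k + 1) = j + 1 by omega] at e2
    rw [show j + (2 * k + 2) + 2 - 2 * (k + 1 + 1) = j by omega,
      show j + (2 * k + 2) + 2 - 2 * (k + 1) = j + 2 by omega]
    set N := j + (2 * k + 2) with hN
    have e1' : (N.choose (2 * k + 1) : ℝ) * (2 * k + 1) = N.choose (2 * k) * (j + 2) := by
      exact_mod_cast e1
    have e2' : (N.choose (2 * k + 1 + 1) : ℝ) * (2 * k + 1 + 1) =
      N.choose (2 * k + 1) * (j + 1) := by exact_mod_cast e2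
    have hNr : (N : ℝ) = j + (2 * k + 2) := by simp [hN]
    have hc : (0 : ℝ) < (treesOf (N + 2)).card := by
      exact_mod_cast card_treesOf_pos (by omega)
    push_cast at hcard ⊢
    rw [hNr, div_mul_eq_mul_div, div_mul_eq_mul_div]
    congr 1
    set T := ((treesOf (k + 1)).card : ℝ)
    set T' := ((treesOf (k + 1 + 1)).card : ℝ)
    set A := (N.choose (2 * k) : ℝ)
    set B := (N.choose (2 * k + 1) : ℝ)
    set D := (N.choose (2 * k + 1 + 1) : ℝ)
    rw [pow_add]
    linear_combination (4 * 2 ^ j * (k + 1) * D) * hcard +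
      (4 * 2 ^ j * (2 * k + 1) * T) * e2' + (4 * 2 ^ j * (j + 1) * T) * e1'

theorem sum_pruneProb_stein {n : ℕ} (hn : 2 ≤ n) (g : ℕ → ℝ) :
    ∑ m ∈ Finset.range (n + 1), pruneProb n m * (4 * m * (m - 1) * g m) =
      ∑ m ∈ Finset.range (n + 1), pruneProb n m * ((n - 2 * m) * (n - 2 * m - 1) * g (m + 1)) := by
  rw [Finset.sum_range_succ', Finset.sum_range_succ _ n, pruneProb_self hn]
  simp only [Nat.cast_zero, mul_zero, zero_mul, add_zero]
  refine Finset.sum_congr rfl fun m _ => ?_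
  have := pruneProb_succ hn m
  push_cast
  linear_combination g (m + 1) * this

/-- The `k`-th moment about `n / 4` of the magnitude of the pruned uniform tree. -/
noncomputable def pruneMoment (n k : ℕ) : ℝ :=
  ∑ m ∈ Finset.range (n + 1), pruneProb n m * ((m : ℝ) - n / 4) ^ k

theorem pruneMoment_zero {n : ℕ} (hn : 2 ≤ n) : pruneMoment n 0 = 1 := by
  simp [pruneMoment, sum_pruneProb hn]

theorem pruneMoment_one {n : ℕ} (hn : 2 ≤ n) : (4 * n - 6) * pruneMoment n 1 = n / 2 := by
  have h := sum_pruneProb_stein hn fun _ => 1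
  have h0 := pruneMoment_zero hn
  suffices (4 * n - 6) * pruneMoment n 1 - n / 2 * pruneMoment n 0 = 0 by
    rw [h0] at this; linarith
  rw [← sub_eq_zero, ← Finset.sum_sub_distrib] at h
  rw [← h, pruneMoment, pruneMoment, Finset.mul_sum, Finset.mul_sum, ← Finset.sum_sub_distrib]
  exact Finset.sum_congr rfl fun m _ => by ring

theorem exists_pow_succ_sub_eq (k : ℕ) : ∃ c : ℕ → ℝ, ∀ y : ℝ,
    y ^ (k + 1) - (y - 1) ^ (k + 1) = (k + 1) * y ^ k + ∑ j ∈ Finset.range k, c j * y ^ j := by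
  refine ⟨fun j => -((-1) ^ (k + 1 - j) * (k + 1).choose j), fun y => ?_⟩
  rw [sub_eq_add_neg y 1, add_pow, Finset.sum_range_succ, Finset.sum_range_succ]
  simp only [neg_mul, Finset.sum_neg_distrib, Nat.choose_self, Nat.choose_succ_self_right]
  rw [Nat.sub_self, show k + 1 - k = 1 by omega, Finset.sum_congr rfl fun j _ => by
    rw [mul_assoc, mul_comm (y ^ j)]]
  push_cast
  ring

theorem exists_pruneMoment_recurrence (k : ℕ) : ∃ c : ℕ → ℝ, ∀ n : ℕ, 2 ≤ n →
    (4 * n - 4 * k - 10) * pruneMoment n (k + 2) =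
      (n : ℝ) ^ 2 / 4 * (k + 1) * pruneMoment n k +
      ((k + 1) * (2 * n * pruneMoment n (k + 1) - n * pruneMoment n k - 4 * pruneMoment n (k + 1))
      + n / 2 * pruneMoment n (k + 1)
      + ∑ j ∈ Finset.range k, c j * (n ^ 2 / 4 * pruneMoment n j + 2 * n * pruneMoment n (j + 1) +
        4 * pruneMoment n (j + 2) - n * pruneMoment n j - 4 * pruneMoment n (j + 1))) := by
  obtain ⟨c, hc⟩ := exists_pow_succ_sub_eq k
  refine ⟨c, fun n hn => ?_⟩
  have h := sum_pruneProb_stein hn fun m => ((m : ℝ) - n / 4 - 1) ^ (k + 1)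
  have hsum : ∑ j ∈ Finset.range k, c j * (n ^ 2 / 4 * pruneMoment n j +
      2 * n * pruneMoment n (j + 1) + 4 * pruneMoment n (j + 2) - n * pruneMoment n j -
      4 * pruneMoment n (j + 1)) = ∑ m ∈ Finset.range (n + 1), pruneProb n m *
      ((4 * m * (m - 1)) * ∑ j ∈ Finset.range k, c j * ((m : ℝ) - n / 4) ^ j) := by
    simp only [pruneMoment, Finset.mul_sum, ← Finset.sum_sub_distrib, ← Finset.sum_add_distrib]
    rw [Finset.sum_comm]
    exact Finset.sum_congr rfl fun m _ => Finset.sum_congr rfl fun j _ => by ring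
  rw [hsum, ← sub_eq_zero]
  rw [← sub_eq_zero, ← Finset.sum_sub_distrib] at h
  rw [← h]
  simp only [pruneMoment, Finset.mul_sum (Finset.range (n + 1)), ← Finset.sum_sub_distrib,
    ← Finset.sum_add_distrib]
  refine Finset.sum_congr rfl fun m _ => ?_
  have := hc ((m : ℝ) - n / 4)
  push_cast
  rw [show (m : ℝ) + 1 - n / 4 - 1 = m - n / 4 by ring]
  linear_combination (pruneProb n m * (4 * m * (m - 1))) * this

open Asymptotics

theorem isBigO_const_mul_pow_mul {f : ℕ → ℝ} {a i b : ℕ}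
    (hf : f =O[atTop] fun n : ℕ => (n : ℝ) ^ a) (h : i + a ≤ b) (c : ℝ) :
    (fun n : ℕ => c * (n : ℝ) ^ i * f n) =O[atTop] fun n : ℕ => (n : ℝ) ^ b := by
  have h1 : (fun n : ℕ => c * (n : ℝ) ^ i * f n) =O[atTop] fun n : ℕ => (n : ℝ) ^ (i + a) := by
    simp_rw [pow_add]
    exact (isBigO_const_mul_self c _ _).mul hf
  refine h1.trans (IsBigO.of_bound 1 ?_)
  filter_upwards [eventually_ge_atTop 1] with n hn
  have : (1 : ℝ) ≤ n := by exact_mod_cast hn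
  rw [one_mul, norm_pow, norm_pow]
  exact pow_le_pow_right₀ (by simpa using this) h

theorem isBigO_pruneMoment_remainder (k : ℕ) (c : ℕ → ℝ)
    (h : ∀ j ≤ k + 1, (fun n : ℕ => pruneMoment n j) =O[atTop] fun n : ℕ => (n : ℝ) ^ (j / 2)) :
    (fun n : ℕ => (k + 1) *
        (2 * n * pruneMoment n (k + 1) - n * pruneMoment n k - 4 * pruneMoment n (k + 1))
      + n / 2 * pruneMoment n (k + 1)
      + ∑ j ∈ Finset.range k, c j * (n ^ 2 / 4 * pruneMoment n j + 2 * n * pruneMoment n (j + 1) +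
        4 * pruneMoment n (j + 2) - n * pruneMoment n j - 4 * pruneMoment n (j + 1)))
      =O[atTop] fun n : ℕ => (n : ℝ) ^ (1 + (k + 1) / 2) := by
  have key : ∀ (j i : ℕ) (d : ℝ), j ≤ k + 1 → i + j / 2 ≤ 1 + (k + 1) / 2 →
      (fun n : ℕ => d * (n : ℝ) ^ i * pruneMoment n j) =O[atTop]
        fun n : ℕ => (n : ℝ) ^ (1 + (k + 1) / 2) :=
    fun j i d hj hi => isBigO_const_mul_pow_mul (h j hj) hi d
  have h1 := (((key (k + 1) 1 ((k + 1) * 2) (by omega) (by omega)).sub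
    (key k 1 (k + 1) (by omega) (by omega))).sub
    (key (k + 1) 0 ((k + 1) * 4) (by omega) (by omega))).add
    (key (k + 1) 1 (1 / 2) (by omega) (by omega))
  refine (h1.congr_left fun n => ?_).add (IsBigO.fun_sum fun j hj => ?_)
  · ring
  · have hj := Finset.mem_range.1 hj
    refine (((((key j 2 (c j / 4) (by omega) (by omega)).add
      (key (j + 1) 1 (c j * 2) (by omega) (by omega))).add
      (key (j + 2) 0 (c j * 4) (by omega) (by omega))).sub
      (key j 1 (c j) (by omega) (by omega))).sub
      (key (j + 1) 0 (c j * 4) (by omega) (by omega))).congr_left fun n => ?_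
    ring

theorem isBigO_of_affine_mul {f : ℕ → ℝ} {a : ℝ} {b : ℕ}
    (h : (fun n : ℕ => (4 * n - a) * f n) =O[atTop] fun n : ℕ => (n : ℝ) ^ (b + 1)) :
    f =O[atTop] fun n : ℕ => (n : ℝ) ^ b := by
  obtain ⟨C, hC⟩ := h.bound
  refine IsBigO.of_bound C ?_
  filter_upwards [hC, eventually_ge_atTop 1, eventually_ge_atTop ⌈a⌉₊] with n hn h1 ha
  have h1 : (1 : ℝ) ≤ n := by exact_mod_cast h1
  have ha : a ≤ n := Nat.ceil_le.1 ha
  simp only [norm_mul, norm_pow, Real.norm_eq_abs, Nat.abs_cast] at hn ⊢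
  rw [abs_of_nonneg (by linarith : 0 ≤ 4 * (n : ℝ) - a)] at hn
  have : (n : ℝ) * |f n| ≤ n * (C * n ^ b) := by
    calc (n : ℝ) * |f n| ≤ (4 * n - a) * |f n| := by gcongr; linarith
      _ ≤ C * n ^ (b + 1) := hn
      _ = _ := by ring
  exact le_of_mul_le_mul_left this (by linarith)

theorem isBigO_pruneMoment (k : ℕ) :
    (fun n : ℕ => pruneMoment n k) =O[atTop] fun n : ℕ => (n : ℝ) ^ (k / 2) := by
  induction k using Nat.strong_induction_on with
  | _ k ih =>
    match k with
    | 0 =>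
      refine IsBigO.of_bound 1 ?_
      filter_upwards [eventually_ge_atTop 2] with n hn
      simp [pruneMoment_zero hn]
    | 1 =>
      refine isBigO_of_affine_mul (a := 6) (IsBigO.of_bound 1 ?_)
      filter_upwards [eventually_ge_atTop 2] with n hn
      rw [pruneMoment_one hn]
      have : (0 : ℝ) ≤ n := n.cast_nonneg
      simp
    | k + 2 =>
      obtain ⟨c, hc⟩ := exists_pruneMoment_recurrence k
      refine isBigO_of_affine_mul (a := 4 * k + 10) ?_
      have hmain := isBigO_const_mul_pow_mul (ih k (by omega))
        (show 2 + k / 2 ≤ (k + 2) / 2 + 1 by omega) ((k + 1) / 4)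
      have hrem := isBigO_const_mul_pow_mul
        (isBigO_pruneMoment_remainder k c fun j hj => ih j (by omega))
        (show 0 + (1 + (k + 1) / 2) ≤ (k + 2) / 2 + 1 by omega) 1
      refine (hmain.add hrem).congr' ?_ EventuallyEq.rfl
      filter_upwards [eventually_ge_atTop 2] with n hn
      linear_combination - hc n hn

theorem tendsto_pruneMoment_even (s : ℕ) :
    Tendsto (fun n : ℕ => pruneMoment n (2 * s) / (n : ℝ) ^ s) atTop
      (𝓝 ((2 * s - 1).doubleFactorial / 16 ^ s)) := by
  induction s with
  | zero =>
    refine tendsto_const_nhds.congr' ?_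
    filter_upwards [eventually_ge_atTop 2] with n hn
    simp [pruneMoment_zero hn]
  | succ s ih =>
    obtain ⟨c, hc⟩ := exists_pruneMoment_recurrence (2 * s)
    have hrem := isBigO_pruneMoment_remainder (2 * s) c fun j _ => isBigO_pruneMoment j
    rw [show 1 + (2 * s + 1) / 2 = s + 1 by omega] at hrem
    have hlt : (fun n : ℕ => (n : ℝ) ^ (s + 1)) =o[atTop] fun n : ℕ => (n : ℝ) ^ (s + 2) :=
      (isLittleO_pow_pow_atTop_of_lt (𝕜 := ℝ) (by omega)).comp_tendsto
        tendsto_natCast_atTop_atTop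
    have hzero := (hrem.trans_isLittleO hlt).tendsto_div_nhds_zero
    have hden : Tendsto (fun n : ℕ => 4 - (4 * (2 * s : ℕ) + 10) / (n : ℝ)) atTop (𝓝 (4 - 0)) :=
      tendsto_const_nhds.sub (tendsto_const_nhds.div_atTop tendsto_natCast_atTop_atTop)
    have hlim := ((ih.const_mul (((2 * s : ℕ) + 1) / 4 : ℝ)).add hzero).div hden (by norm_num)
    have hval : (((2 * s : ℕ) + 1 : ℝ) / 4 * ((2 * s - 1).doubleFactorial / 16 ^ s) + 0) / (4 - 0) =
        (2 * (s + 1) - 1).doubleFactorial / 16 ^ (s + 1) := by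
      rw [show 2 * (s + 1) - 1 = 2 * s + 1 by omega, Nat.doubleFactorial_add_one]
      push_cast
      field_simp
      ring
    rw [hval] at hlim
    refine hlim.congr' ?_
    filter_upwards [eventually_gt_atTop (2 * s + 3)] with n hn
    have hrec := hc n (by omega)
    have hn' : (2 * s + 3 : ℝ) < n := by exact_mod_cast hn
    have hs : (0 : ℝ) ≤ s := s.cast_nonneg
    have hn0 : (0 : ℝ) < n := by linarith
    have hne : (4 * n - 4 * (2 * s : ℕ) - 10 : ℝ) ≠ 0 := by
      have : (0 : ℝ) < 4 * n - 4 * (2 * s : ℕ) - 10 := by push_cast; linarith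
      exact this.ne'
    simp only [Pi.div_apply]
    rw [show 4 - (4 * (2 * s : ℕ) + 10) / (n : ℝ) = (4 * n - 4 * (2 * s : ℕ) - 10) / n by
      field_simp; ring, show 2 * (s + 1) = 2 * s + 2 by ring]
    rw [div_eq_iff (div_ne_zero hne hn0.ne'), div_mul_div_comm (pruneMoment n (2 * s + 2)),
      mul_comm (pruneMoment n (2 * s + 2)), hrec, ← pow_succ]
    field_simp
    ring

theorem abs_sum_pruneProb_sub_le {n : ℕ} (hn : 2 ≤ n) {b : ℕ → ℝ} {L A B : ℝ} {k : ℕ}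
    (h : ∀ m, 1 ≤ m → |b m - L| ≤ A + B * ((m : ℝ) - n / 4) ^ k) :
    |∑ m ∈ Finset.range (n + 1), pruneProb n m * b m - L| ≤ A + B * pruneMoment n k := by
  have h1 : ∑ m ∈ Finset.range (n + 1), pruneProb n m * b m - L =
      ∑ m ∈ Finset.range (n + 1), pruneProb n m * (b m - L) := by
    simp_rw [mul_sub, Finset.sum_sub_distrib, ← Finset.sum_mul, sum_pruneProb hn, one_mul]
  have h2 : A + B * pruneMoment n k =
      ∑ m ∈ Finset.range (n + 1), pruneProb n m * (A + B * ((m : ℝ) - n / 4) ^ k) := by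
    simp_rw [mul_add, Finset.sum_add_distrib, ← Finset.sum_mul, sum_pruneProb hn, one_mul,
      pruneMoment, Finset.mul_sum]
    congr 1
    exact Finset.sum_congr rfl fun m _ => by ring
  rw [h1, h2]
  refine (Finset.abs_sum_le_sum_abs _ _).trans (Finset.sum_le_sum fun m _ => ?_)
  rw [abs_mul, abs_of_nonneg (pruneProb_nonneg n m)]
  rcases Nat.eq_zero_or_pos m with rfl | hm
  · simp [pruneProb_zero_right]
  · exact mul_le_mul_of_nonneg_left (h m hm) (pruneProb_nonneg n m)

theorem exists_abs_sub_lt_of_near_quarter {a : ℕ → ℝ} {L ε : ℝ} {s : ℕ}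
    (ha : Tendsto (fun m : ℕ => (m : ℝ) ^ s * a m) atTop (𝓝 L)) (hε : 0 < ε) :
    ∃ δ > 0, ∃ N : ℕ, ∀ n m : ℕ, N ≤ n → 1 ≤ m → |(m : ℝ) / n - 1 / 4| < δ →
      |(n : ℝ) ^ s * a m - 4 ^ s * L| < ε := by
  have hcont : ContinuousAt (fun p : ℝ × ℝ => (p.1⁻¹) ^ s * p.2) (1 / 4, L) := by
    refine ContinuousAt.mul (ContinuousAt.pow (ContinuousAt.inv₀ continuousAt_fst ?_) s)
      continuousAt_snd
    norm_num
  obtain ⟨δ, hδ, hball⟩ := Metric.continuousAt_iff.1 hcont ε hε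
  obtain ⟨M, hM⟩ := Metric.tendsto_atTop.1 ha δ hδ
  refine ⟨min δ (1 / 8), by positivity, 8 * M + 1, fun n m hn hm hnm => ?_⟩
  have hn0 : (0 : ℝ) < n := by exact_mod_cast (show 0 < n by omega)
  have hm0 : (0 : ℝ) < m := by exact_mod_cast hm
  have hmM : M ≤ m := by
    have h1 := (abs_lt.1 (hnm.trans_le (min_le_right _ _))).1
    have h2 : (1 : ℝ) / 8 < m / n := by linarith
    rw [lt_div_iff₀ hn0] at h2
    have h3 : (8 * M + 1 : ℝ) ≤ n := by exact_mod_cast hn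
    have h4 : (M : ℝ) ≤ m := by linarith
    exact_mod_cast h4
  have := @hball ((m : ℝ) / n, (m : ℝ) ^ s * a m) (by
    rw [Prod.dist_eq, max_lt_iff]
    exact ⟨hnm.trans_le (min_le_left _ _), hM m hmM⟩)
  rw [Real.dist_eq] at this
  convert this using 3
  · simp only [inv_div, div_pow]
    field_simp
  · simp

theorem tendsto_pow_mul_sum_pruneProb {a : ℕ → ℝ} {L : ℝ} {s : ℕ}
    (ha : Tendsto (fun m : ℕ => (m : ℝ) ^ s * a m) atTop (𝓝 L)) :
    Tendsto (fun n : ℕ => (n : ℝ) ^ s * ∑ m ∈ Finset.range (n + 1), pruneProb n m * a m) atTop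
      (𝓝 (4 ^ s * L)) := by
  obtain ⟨K, hK⟩ := (Metric.isBounded_range_of_tendsto _ ha).exists_norm_le
  replace hK : ∀ m : ℕ, |(m : ℝ) ^ s * a m| ≤ K := fun m => hK _ ⟨m, rfl⟩
  have ha_le : ∀ m : ℕ, 1 ≤ m → |a m| ≤ K := fun m hm => by
    refine le_trans ?_ (hK m)
    rw [abs_mul]
    refine le_mul_of_one_le_left (abs_nonneg _) ?_
    rw [abs_pow, Nat.abs_cast]
    exact one_le_pow₀ (by exact_mod_cast hm)
  have hK0 : 0 ≤ K := (abs_nonneg _).trans (hK 0)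
  set k := s + 1
  have hmom : Tendsto (fun n : ℕ => (n : ℝ) ^ s * pruneMoment n (2 * k) / (n : ℝ) ^ (2 * k)) atTop
      (𝓝 0) := by
    have h := (tendsto_pruneMoment_even k).mul (tendsto_inv_atTop_nhds_zero_nat (𝕜 := ℝ))
    rw [mul_zero] at h
    refine h.congr' ?_
    filter_upwards [eventually_ge_atTop 1] with n hn
    have : (n : ℝ) ≠ 0 := by exact_mod_cast (show n ≠ 0 by omega)
    simp only [k]
    field_simp
    ring
  rw [Metric.tendsto_atTop']
  intro ε hε
  obtain ⟨δ, hδ, N, hN⟩ := exists_abs_sub_lt_of_near_quarter ha (half_pos hε)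
  set C := (K + 4 ^ s * |L|) / δ ^ (2 * k)
  have hC : 0 ≤ C := by positivity
  have hsmall := (hmom.const_mul C)
  rw [mul_zero] at hsmall
  obtain ⟨N', hN'⟩ := eventually_atTop.1 (hsmall.eventually_lt_const (half_pos hε))
  refine ⟨max (max N N') 2, fun n hn => ?_⟩
  simp only [gt_iff_lt, max_lt_iff] at hn
  obtain ⟨⟨hnN, hnN'⟩, hn2⟩ := hn
  have hn0 : (0 : ℝ) < n := by exact_mod_cast (show 0 < n by omega)
  have hn1 : (1 : ℝ) ≤ n := by exact_mod_cast (show 1 ≤ n by omega)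
  have hbound : ∀ m : ℕ, 1 ≤ m → |(n : ℝ) ^ s * a m - 4 ^ s * L| ≤
      ε / 2 + C * (n ^ s / n ^ (2 * k)) * ((m : ℝ) - n / 4) ^ (2 * k) := by
    intro m hm
    have hev : 0 ≤ ((m : ℝ) - n / 4) ^ (2 * k) := (even_two_mul k).pow_nonneg _
    rcases lt_or_ge |(m : ℝ) / n - 1 / 4| δ with hlt | hge
    · exact (hN n m hnN.le hm hlt).le.trans (le_add_of_nonneg_right (by positivity))
    · have hpow : δ ^ (2 * k) ≤ ((m : ℝ) - n / 4) ^ (2 * k) / n ^ (2 * k) := by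
        rw [← div_pow, ← (even_two_mul k).pow_abs (((m : ℝ) - n / 4) / n)]
        refine pow_le_pow_left₀ hδ.le ?_ _
        rwa [show ((m : ℝ) - n / 4) / n = m / n - 1 / 4 by field_simp]
      have hns : (1 : ℝ) ≤ (n : ℝ) ^ s := one_le_pow₀ hn1
      calc |(n : ℝ) ^ s * a m - 4 ^ s * L| ≤ |(n : ℝ) ^ s * a m| + |4 ^ s * L| := abs_sub _ _
        _ = (n : ℝ) ^ s * |a m| + 4 ^ s * |L| := by
          rw [abs_mul, abs_mul, abs_of_nonneg (by positivity : (0 : ℝ) ≤ (n : ℝ) ^ s),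
            abs_of_nonneg (by positivity : (0 : ℝ) ≤ 4 ^ s)]
        _ ≤ (n : ℝ) ^ s * K + n ^ s * (4 ^ s * |L|) := by
          exact add_le_add (mul_le_mul_of_nonneg_left (ha_le m hm) (by positivity))
            (le_mul_of_one_le_left (by positivity) hns)
        _ = C * n ^ s * δ ^ (2 * k) := by simp only [C]; field_simp
        _ ≤ C * n ^ s * (((m : ℝ) - n / 4) ^ (2 * k) / n ^ (2 * k)) := by gcongr
        _ = C * (n ^ s / n ^ (2 * k)) * ((m : ℝ) - n / 4) ^ (2 * k) := by ring
        _ ≤ _ := le_add_of_nonneg_left (by positivity)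
  have hle := abs_sum_pruneProb_sub_le hn2.le hbound
  have hlt := hN' n hnN'.le
  rw [Real.dist_eq, Finset.mul_sum]
  rw [Finset.sum_congr rfl fun m _ => mul_left_comm ((n : ℝ) ^ s) (pruneProb n m) (a m)]
  refine hle.trans_lt ?_
  have : C * (n ^ s / n ^ (2 * k)) * pruneMoment n (2 * k) =
    C * (n ^ s * pruneMoment n (2 * k) / n ^ (2 * k)) := by ring
  linarith

/-- The moment of order `k` of the deviation of the bifurcation ratio of order `r`. -/
noncomputable def ratioMoment (r k n : ℕ) : ℝ :=
  expect n fun τ => ((branches (r + 1) τ : ℝ) / (branches r τ : ℝ) - 1 / 4) ^ k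

theorem ratioMoment_one {n : ℕ} (hn : 2 ≤ n) (k : ℕ) :
    ratioMoment 1 k n = pruneMoment n k / (n : ℝ) ^ k := by
  have hn0 : (n : ℝ) ≠ 0 := by exact_mod_cast (show n ≠ 0 by omega)
  rw [ratioMoment, expect_eq_sum_of_magnitude hn (φ := fun m => ((m : ℝ) / n - 1 / 4) ^ k),
    pruneMoment, Finset.sum_div]
  · refine Finset.sum_congr rfl fun m _ => ?_
    rw [mul_div_assoc, ← div_pow]
    congr 2
    field_simp
  · intro τ σ hτ h
    simp only [branches_of_prune h le_rfl, branches_one, hτ]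

theorem ratioMoment_succ {n r : ℕ} (hn : 2 ≤ n) (hr : 1 ≤ r) (k : ℕ) :
    ratioMoment (r + 1) k n =
      ∑ m ∈ Finset.range (n + 1), pruneProb n m * ratioMoment r k m :=
  expect_eq_sum_pruneProb hn fun τ σ _ h => by
    rw [branches_of_prune h hr, branches_of_prune h (by omega : 1 ≤ r + 1)]

theorem tendsto_pow_mul_ratioMoment (s r : ℕ) :
    Tendsto (fun n : ℕ => (n : ℝ) ^ s * ratioMoment (r + 1) (2 * s) n) atTop
      (𝓝 ((4 ^ s) ^ r * ((2 * s - 1).doubleFactorial / 16 ^ s))) := by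
  induction r with
  | zero =>
    rw [pow_zero, one_mul]
    refine (tendsto_pruneMoment_even s).congr' ?_
    filter_upwards [eventually_ge_atTop 2] with n hn
    have hn0 : (n : ℝ) ≠ 0 := by exact_mod_cast (show n ≠ 0 by omega)
    rw [zero_add, ratioMoment_one hn]
    field_simp
    ring
  | succ r ih =>
    rw [pow_succ', mul_assoc]
    refine (tendsto_pow_mul_sum_pruneProb ih).congr' ?_
    filter_upwards [eventually_ge_atTop 2] with n hn
    rw [ratioMoment_succ hn (by omega)]

end BinTree

/-- Even moments of the bifurcation ratio deviation (Lemma 1, even case): for `r ≥ 1`, `s ≥ 0`,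
`⟨(S_{r+1,n}/S_{r,n} − 1/4)^{2s}⟩ ∼ ((2s−1)!!/4^{2s}) (n/4^{r−1})^{−s}`. -/
theorem even_moments_bifurcation_ratio (r s : ℕ) (hr : 1 ≤ r) :
    Tendsto (fun n : ℕ =>
        expect n (fun τ =>
            ((BinTree.branches (r+1) τ : ℝ) / (BinTree.branches r τ : ℝ) - 1/4) ^ (2*s))
          / ((Nat.doubleFactorial (2*s - 1) : ℝ) / 4 ^ (2*s)
              * ((n : ℝ) / 4 ^ (r - 1)) ^ (-(s : ℤ))))
      atTop (𝓝 1) := by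
  obtain ⟨r, rfl⟩ := Nat.exists_eq_add_of_le' hr
  have hd : (0 : ℝ) < (2 * s - 1).doubleFactorial := by
    exact_mod_cast Nat.doubleFactorial_pos _
  have hL : (4 ^ s) ^ r * ((2 * s - 1).doubleFactorial / 16 ^ s : ℝ) ≠ 0 := by positivity
  have h := (BinTree.tendsto_pow_mul_ratioMoment s r).div_const
    ((4 ^ s) ^ r * ((2 * s - 1).doubleFactorial / 16 ^ s))
  rw [div_self hL] at h
  refine h.congr' ?_
  filter_upwards [eventually_ge_atTop 1] with n hn
  have hn0 : (n : ℝ) ≠ 0 := by exact_mod_cast (show n ≠ 0 by omega)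
  change _ = BinTree.ratioMoment (r + 1) (2 * s) n / _
  rw [Nat.add_sub_cancel, zpow_neg, zpow_natCast, div_pow, pow_mul (4 : ℝ) 2 s,
    pow_right_comm (4 : ℝ) r s]
  norm_num1
  field_simp
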